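/- arXiv:2405.16663 — 4 statements merged into one kernel-verified Lean document; each statement's English description precedes it below -/
import Mathlib

section
/- There exist absolute constants c, c', C > 0 such that the following holds for all sufficiently large n. Let Q° ∈ [0,1]^{n×n} be symmetric with zero diagonal, let d° := d(Q°) ≥ C, let R ≥ 1 satisfy Q°_ij ≤ R·d°/n for all i,j and R·d° ≥ 5, and let η ∈ (0, 1/e) satisfy η·log(1/η)·R ≤ c. Then with probability at least 1 − n^{−c'} over a random graph A° drawn from G(n,Q°), the following holds: for every n-node graph A with dist(A, A°) ≤ η·n and every pair (Y, z) satisfying the feasibility constraints P1(A, 2η) with (Y·𝟙)_i ≤ 2·log(1/η)·R·d(Y) for all i, one has (1/2)·d° ≤ d(Y) ≤ (3/2)·d°. -/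
open scoped BigOperators Classical

namespace EdgeDensity

/-- A graph on `n` nodes, identified with its Boolean adjacency function:
symmetric with no self-loops. -/
def IsGraph {n : ℕ} (A : Fin n → Fin n → Bool) : Prop :=
  (∀ i j, A i j = A j i) ∧ ∀ i, A i i = false

/-- The real adjacency matrix of a Boolean graph. -/
def adjMat {n : ℕ} (A : Fin n → Fin n → Bool) : Matrix (Fin n) (Fin n) ℝ :=
  Matrix.of fun i j => if A i j then 1 else 0

/-- `d(M) = (1/n) ∑_{i,j} M i j`, the average row sum. -/
noncomputable def dbar {n : ℕ} (M : Matrix (Fin n) (Fin n) ℝ) : ℝ :=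
  (∑ i, ∑ j, M i j) / n

/-- `(M 𝟙)_i = ∑_j M i j`, the `i`-th row sum (degree of node `i`). -/
def rowSum {n : ℕ} (M : Matrix (Fin n) (Fin n) ℝ) (i : Fin n) : ℝ := ∑ j, M i j

/-- The probability that the inhomogeneous random graph `G(n,Q)` equals the
given graph `A`: each edge `{i,j}` with `i < j` is present independently with
probability `Q i j`. -/
noncomputable def erWeight {n : ℕ} (Q : Matrix (Fin n) (Fin n) ℝ)
    (A : Fin n → Fin n → Bool) : ℝ :=
  ∏ i, ∏ j ∈ Finset.univ.filter (fun j => i < j),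
    (if A i j then Q i j else 1 - Q i j)

/-- Probability of the event `E` under the inhomogeneous random graph `G(n,Q)`. -/
noncomputable def erProb {n : ℕ} (Q : Matrix (Fin n) (Fin n) ℝ)
    (E : (Fin n → Fin n → Bool) → Prop) : ℝ :=
  ∑ A ∈ Finset.univ.filter (fun A => IsGraph A ∧ E A), erWeight Q A

/-- Node distance between two graphs: the minimum cardinality of a set `S` of
nodes such that the two adjacency matrices agree on all entries `(i,j)` with
`i ∉ S` and `j ∉ S`. -/
noncomputable def nodeDist {n : ℕ} (A B : Fin n → Fin n → Bool) : ℕ :=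
  sInf {k | ∃ S : Finset (Fin n), S.card = k ∧
    ∀ i j, i ∉ S → j ∉ S → A i j = B i j}

/-- The feasibility constraints `P1(A, γ)` on a pair `(Y, z)`. -/
def P1 {n : ℕ} (A : Matrix (Fin n) (Fin n) ℝ) (γ : ℝ)
    (Y : Matrix (Fin n) (Fin n) ℝ) (z : Fin n → ℝ) : Prop :=
  (∀ i, z i = 0 ∨ z i = 1) ∧
  ((1 - γ) * n ≤ ∑ i, z i) ∧
  (∀ i j, Y i j = Y j i) ∧
  (∀ i j, 0 ≤ Y i j ∧ Y i j ≤ 1) ∧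
  (∀ i j, Y i j * z i * z j = A i j * z i * z j)

/-- The binomial probability mass function `Bin(n,p)` at `k`. -/
noncomputable def binomPMF (n : ℕ) (p : ℝ) (k : ℕ) : ℝ :=
  (n.choose k : ℝ) * p ^ k * (1 - p) ^ (n - k)

/-- Total variation distance between `Bin(n,p)` and `Bin(n,q)`. -/
noncomputable def binomTV (n : ℕ) (p q : ℝ) : ℝ :=
  (∑ k ∈ Finset.range (n + 1), |binomPMF n p k - binomPMF n q k|) / 2

/-- The spectral norm (largest singular value) of a real square matrix. -/
noncomputable def specNorm {n : ℕ} (M : Matrix (Fin n) (Fin n) ℝ) : ℝ :=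
  ‖LinearMap.toContinuousLinearMap (Matrix.toEuclideanLin M)‖

/-- A randomized algorithm on `n`-node graphs is `ε`-differentially
node-private. -/
def IsNodeDP {n : ℕ} (ε : ℝ)
    (𝒜 : (Fin n → Fin n → Bool) → MeasureTheory.Measure ℝ) : Prop :=
  ∀ G G', IsGraph G → IsGraph G' → nodeDist G G' ≤ 1 →
    ∀ S : Set ℝ, MeasurableSet S →
      𝒜 G S ≤ ENNReal.ofReal (Real.exp ε) * 𝒜 G' S

/-- `Pr_{G ~ G(n,Q), 𝒜}[𝒜(G) ∈ S]`. -/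
noncomputable def algProb {n : ℕ} (Q : Matrix (Fin n) (Fin n) ℝ)
    (𝒜 : (Fin n → Fin n → Bool) → MeasureTheory.Measure ℝ) (S : Set ℝ) : ℝ :=
  ∑ A ∈ Finset.univ.filter (fun A => IsGraph A), erWeight Q A * (𝒜 A S).toReal


/-- The expectation of `X` under the inhomogeneous random graph `G(n,Q)`. -/
noncomputable def erExp {n : ℕ} (Q : Matrix (Fin n) (Fin n) ℝ)
    (X : (Fin n → Fin n → Bool) → ℝ) : ℝ :=
  ∑ A ∈ Finset.univ.filter (fun A => IsGraph A), erWeight Q A * X A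

/-- A product over pairs `i < j` of functions of single edges factorizes when summed over all
graphs. -/
lemma sum_graph_prod {n : ℕ} (g : Fin n → Fin n → Bool → ℝ) :
    ∑ A ∈ Finset.univ.filter (fun A : Fin n → Fin n → Bool => IsGraph A),
      ∏ i, ∏ j ∈ Finset.univ.filter (fun j => i < j), g i j (A i j)
      = ∏ i, ∏ j ∈ Finset.univ.filter (fun j => i < j), (g i j true + g i j false) := by
  have hprod : ∀ h : Fin n → Fin n → ℝ,
      ∏ i, ∏ j ∈ Finset.univ.filter (fun j => i < j), h i j
        = ∏ p : {p : Fin n × Fin n // p.1 < p.2}, h p.1.1 p.1.2 := by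
    intro h
    rw [← Finset.prod_subtype (Finset.univ.filter fun p : Fin n × Fin n => p.1 < p.2)
      (by simp) (fun p => h p.1 p.2), Finset.prod_filter, Fintype.prod_prod_type]
    exact Finset.prod_congr rfl fun i _ => Finset.prod_filter _ _
  simp_rw [hprod]
  have hexp := Finset.prod_univ_sum
    (fun _ : {p : Fin n × Fin n // p.1 < p.2} => (Finset.univ : Finset Bool))
    (fun p b => g p.1.1 p.1.2 b)
  simp only [Fintype.sum_bool, Fintype.piFinset_univ] at hexp
  rw [hexp]
  refine Finset.sum_nbij' (fun A p => A p.1.1 p.1.2)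
    (fun f i j => if h : i < j then f ⟨(i, j), h⟩ else
      if h : j < i then f ⟨(j, i), h⟩ else false) ?_ ?_ ?_ ?_ ?_
  · simp
  · intro f _
    simp only [Finset.mem_filter, Finset.mem_univ, true_and]
    refine ⟨fun i j => ?_, fun i => by simp⟩
    rcases lt_trichotomy i j with h | h | h
    · simp [h, h.not_gt]
    · simp [h]
    · simp [h, h.not_gt]
  · intro A hA
    obtain ⟨hs, hd⟩ := (Finset.mem_filter.1 hA).2
    funext i j
    rcases lt_trichotomy i j with h | h | h
    · simp [h]
    · simp [h, hd]
    · simp [h, h.not_gt, hs i j]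
  · intro f _
    funext p
    simp [p.2]
  · intro A _
    rfl

/-- Summing a function with zero diagonal by unordered pairs. -/
lemma sum_eq_sum_lt {n : ℕ} (F : Fin n → Fin n → ℝ) (h0 : ∀ i, F i i = 0) :
    ∑ i, ∑ j, F i j = ∑ i, ∑ j ∈ Finset.univ.filter (fun j => i < j), (F i j + F j i) := by
  have h1 : ∀ i j, F i j = (if i < j then F i j else 0) + (if j < i then F i j else 0) := by
    intro i j
    rcases lt_trichotomy i j with h | h | h
    · simp [h, h.not_gt]
    · simp [h, h0]
    · simp [h, h.not_gt]
  simp_rw [Finset.sum_filter]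
  calc ∑ i, ∑ j, F i j
      = ∑ i, ∑ j, ((if i < j then F i j else 0) + (if j < i then F i j else 0)) :=
        Finset.sum_congr rfl fun i _ => Finset.sum_congr rfl fun j _ => h1 i j
    _ = (∑ i, ∑ j, if i < j then F i j else 0) + ∑ i, ∑ j, if i < j then F j i else 0 := by
        simp_rw [Finset.sum_add_distrib]
        congr 1
        exact Finset.sum_comm
    _ = _ := by
        rw [← Finset.sum_add_distrib]
        refine Finset.sum_congr rfl fun i _ => ?_
        rw [← Finset.sum_add_distrib]
        refine Finset.sum_congr rfl fun j _ => ?_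
        split_ifs <;> simp

lemma erWeight_nonneg {n : ℕ} {Q : Matrix (Fin n) (Fin n) ℝ}
    (hQ : ∀ i j, 0 ≤ Q i j ∧ Q i j ≤ 1) (A : Fin n → Fin n → Bool) : 0 ≤ erWeight Q A := by
  refine Finset.prod_nonneg fun i _ => Finset.prod_nonneg fun j _ => ?_
  have := hQ i j
  split_ifs <;> linarith

lemma sum_erWeight {n : ℕ} (Q : Matrix (Fin n) (Fin n) ℝ) :
    ∑ A ∈ Finset.univ.filter (fun A : Fin n → Fin n → Bool => IsGraph A), erWeight Q A = 1 := by
  have := sum_graph_prod (fun i j b => if b then Q i j else 1 - Q i j)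
  simpa [erWeight] using this

/-- Markov's inequality for `G(n,Q)`. -/
lemma one_sub_erExp_le_erProb {n : ℕ} {Q : Matrix (Fin n) (Fin n) ℝ}
    (hQ : ∀ i j, 0 ≤ Q i j ∧ Q i j ≤ 1) {E : (Fin n → Fin n → Bool) → Prop}
    {X : (Fin n → Fin n → Bool) → ℝ} (hX : ∀ A, 0 ≤ X A)
    (hE : ∀ A, IsGraph A → X A < 1 → E A) : 1 - erExp Q X ≤ erProb Q E := by
  rw [← sum_erWeight Q, erExp, erProb, ← Finset.sum_sub_distrib, ← Finset.filter_filter,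
    Finset.sum_filter E]
  refine Finset.sum_le_sum fun A hA => ?_
  have hw := erWeight_nonneg hQ A
  split_ifs with h
  · nlinarith [hX A]
  · have : 1 ≤ X A := by
      by_contra! h1
      exact h (hE A (Finset.mem_filter.1 hA).2 h1)
    nlinarith

/-- Exponential moment bound for weighted sums of degrees in `G(n,Q)`. -/
lemma erExp_exp_le {n : ℕ} {Q : Matrix (Fin n) (Fin n) ℝ}
    (hsymm : ∀ i j, Q i j = Q j i) (hdiag : ∀ i, Q i i = 0)
    (hQ : ∀ i j, 0 ≤ Q i j ∧ Q i j ≤ 1) (u : Fin n → ℝ) (K s : ℝ)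
    (hK : ∀ i j, Real.exp (u i + u j) - 1 ≤ K * (u i + u j)) :
    erExp Q (fun A => Real.exp (∑ i, u i * rowSum (adjMat A) i - s))
      ≤ Real.exp (K * ∑ i, u i * rowSum Q i - s) := by
  have hrow : ∀ M : Matrix (Fin n) (Fin n) ℝ, (∀ i j, M i j = M j i) → (∀ i, M i i = 0) →
      ∑ i, u i * rowSum M i
        = ∑ i, ∑ j ∈ Finset.univ.filter (fun j => i < j), (u i + u j) * M i j := by
    intro M hs hd
    simp_rw [rowSum, Finset.mul_sum]
    rw [sum_eq_sum_lt _ (by simp [hd])]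
    refine Finset.sum_congr rfl fun i _ => Finset.sum_congr rfl fun j _ => ?_
    rw [hs j i]; ring
  have hA : ∀ A ∈ Finset.univ.filter (fun A : Fin n → Fin n → Bool => IsGraph A),
      erWeight Q A * Real.exp (∑ i, u i * rowSum (adjMat A) i - s)
        = Real.exp (-s) * ∏ i, ∏ j ∈ Finset.univ.filter (fun j => i < j),
            (if A i j then Q i j * Real.exp (u i + u j) else 1 - Q i j) := by
    intro A hA
    obtain ⟨hs, hd⟩ := (Finset.mem_filter.1 hA).2
    rw [hrow (adjMat A) (fun i j => by simp [adjMat, hs i j]) (fun i => by simp [adjMat, hd]),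
      sub_eq_neg_add, Real.exp_add, mul_left_comm, erWeight, Real.exp_sum,
      ← Finset.prod_mul_distrib]
    congr 1
    refine Finset.prod_congr rfl fun i _ => ?_
    rw [Real.exp_sum, ← Finset.prod_mul_distrib]
    refine Finset.prod_congr rfl fun j _ => ?_
    by_cases h : A i j <;> simp [adjMat, h]
  have hfac := sum_graph_prod
    (fun i j b => if b then Q i j * Real.exp (u i + u j) else 1 - Q i j)
  simp only [if_true, Bool.false_eq_true, if_false] at hfac
  rw [erExp, Finset.sum_congr rfl hA, ← Finset.mul_sum, hfac, hrow Q hsymm hdiag,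
    sub_eq_neg_add, Real.exp_add, Finset.mul_sum, Real.exp_sum]
  refine mul_le_mul_of_nonneg_left ?_ (Real.exp_pos _).le
  have hpos : ∀ i j, 0 ≤ Q i j * Real.exp (u i + u j) + (1 - Q i j) := fun i j =>
    add_nonneg (mul_nonneg (hQ i j).1 (Real.exp_pos _).le) (sub_nonneg.2 (hQ i j).2)
  refine Finset.prod_le_prod (fun i _ => Finset.prod_nonneg fun j _ => hpos i j) fun i _ => ?_
  rw [Finset.mul_sum, Real.exp_sum]
  refine Finset.prod_le_prod (fun j _ => hpos i j) fun j _ => ?_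
  have h1 := mul_le_mul_of_nonneg_left (hK i j) (hQ i j).1
  have h2 := Real.add_one_le_exp (K * ((u i + u j) * Q i j))
  linarith

/-- The number of subsets of `Fin n` of size at most `m` is at most `x⁻ᵐ (1 + x)ⁿ`. -/
lemma card_small_subsets_le (n : ℕ) (m x : ℝ) (hx0 : 0 < x) (hx1 : x < 1) :
    ((Finset.univ.filter fun U : Finset (Fin n) => (U.card : ℝ) ≤ m).card : ℝ)
      ≤ Real.exp (m * Real.log (1 / x) + n * x) := by
  have hlog : 0 < Real.log (1 / x) := Real.log_pos (by rw [lt_div_iff₀ hx0]; linarith)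
  have hxe : x = Real.exp (-Real.log (1 / x)) := by
    rw [one_div, Real.log_inv, neg_neg, Real.exp_log hx0]
  have hsum : ∑ U : Finset (Fin n), x ^ U.card = (1 + x) ^ n := by
    have := Finset.prod_add (fun _ : Fin n => x) (fun _ => 1) Finset.univ
    simpa [add_comm] using this.symm
  have h1 : (1 + x) ^ n ≤ Real.exp (n * x) := by
    rw [Real.exp_nat_mul]
    exact pow_le_pow_left₀ (by linarith) (by linarith [Real.add_one_le_exp x]) n
  rw [Real.exp_add, Finset.cast_card, Finset.sum_filter]
  refine le_trans ?_ (mul_le_mul_of_nonneg_left (hsum.le.trans h1) (Real.exp_pos _).le)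
  rw [Finset.mul_sum]
  refine Finset.sum_le_sum fun U _ => ?_
  split_ifs with h
  · rw [hxe, ← Real.exp_nat_mul, ← hxe, ← Real.exp_add]
    refine Real.one_le_exp ?_
    nlinarith
  · positivity

/-- The total of a symmetric nonnegative matrix is bounded by the total over the rows and columns
outside `U` plus twice the row sums in `U`. -/
lemma sum_le_sum_compl_add {n : ℕ} (M : Matrix (Fin n) (Fin n) ℝ) (hs : ∀ i j, M i j = M j i)
    (h0 : ∀ i j, 0 ≤ M i j) (U : Finset (Fin n)) :
    ∑ i, rowSum M i ≤ ∑ i ∈ Uᶜ, ∑ j ∈ Uᶜ, M i j + 2 * ∑ i ∈ U, rowSum M i := by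
  have h1 : ∑ i ∈ Uᶜ, rowSum M i
      ≤ ∑ i ∈ Uᶜ, ∑ j ∈ Uᶜ, M i j + ∑ i ∈ U, rowSum M i := by
    have h2 : ∑ i ∈ Uᶜ, rowSum M i
        = ∑ i ∈ Uᶜ, ∑ j ∈ Uᶜ, M i j + ∑ i ∈ Uᶜ, ∑ j ∈ U, M i j := by
      rw [← Finset.sum_add_distrib]
      exact Finset.sum_congr rfl fun i _ => (Finset.sum_compl_add_sum U _).symm
    have h3 : ∑ i ∈ Uᶜ, ∑ j ∈ U, M i j ≤ ∑ i ∈ U, rowSum M i := by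
      refine (Finset.sum_comm (f := fun i j => M i j)).le.trans (Finset.sum_le_sum fun j _ => ?_)
      rw [Finset.sum_congr rfl fun i _ => hs i j]
      exact Finset.sum_le_sum_of_subset_of_nonneg (Finset.subset_univ _) fun i _ _ => h0 j i
    linarith
  rw [← Finset.sum_compl_add_sum U]
  linarith

/-- Restricting a nonnegative matrix to a principal submatrix decreases its total. -/
lemma sum_sum_compl_le {n : ℕ} (M : Matrix (Fin n) (Fin n) ℝ)
    (h0 : ∀ i j, 0 ≤ M i j) (U : Finset (Fin n)) :
    ∑ i ∈ Uᶜ, ∑ j ∈ Uᶜ, M i j ≤ ∑ i, rowSum M i :=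
  (Finset.sum_le_sum fun i _ => Finset.sum_le_sum_of_subset_of_nonneg (Finset.subset_univ _)
    fun j _ _ => h0 i j).trans
    (Finset.sum_le_sum_of_subset_of_nonneg (Finset.subset_univ _)
      fun i _ _ => Finset.sum_nonneg fun j _ => h0 i j)

lemma exists_finset_of_nodeDist {n : ℕ} (A B : Fin n → Fin n → Bool) :
    ∃ S : Finset (Fin n), S.card = nodeDist A B ∧ ∀ i j, i ∉ S → j ∉ S → A i j = B i j :=
  Nat.sInf_mem (s := {k | ∃ S : Finset (Fin n), S.card = k ∧
    ∀ i j, i ∉ S → j ∉ S → A i j = B i j})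
    ⟨_, Finset.univ, rfl, fun i _ hi => absurd (Finset.mem_univ i) hi⟩

/-- A feasible `Y` agrees with the uncorrupted graph outside a set of at most `3ηn` nodes. -/
lemma exists_agreement_set {n : ℕ} {A A₀ : Fin n → Fin n → Bool} {η : ℝ}
    {Y : Matrix (Fin n) (Fin n) ℝ} {z : Fin n → ℝ}
    (hdist : (nodeDist A A₀ : ℝ) ≤ η * n) (hP : P1 (adjMat A) (2 * η) Y z) :
    ∃ U : Finset (Fin n), (U.card : ℝ) ≤ 3 * η * n ∧
      ∀ i ∈ Uᶜ, ∀ j ∈ Uᶜ, Y i j = adjMat A₀ i j := by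
  obtain ⟨S, hS, hag⟩ := exists_finset_of_nodeDist A A₀
  obtain ⟨hz, hzs, -, -, hYz⟩ := hP
  refine ⟨S ∪ Finset.univ.filter (fun i => z i = 0), ?_, ?_⟩
  · have h1 : ((Finset.univ.filter fun i => z i = 0).card : ℝ) = n - ∑ i, z i := by
      have : ∀ i, z i = 1 - if z i = 0 then 1 else 0 := by
        intro i
        rcases hz i with h | h <;> simp [h]
      rw [Finset.sum_congr rfl fun i _ => this i]
      simp
    have h2 : ((S ∪ Finset.univ.filter fun i => z i = 0).card : ℝ)
        ≤ S.card + (Finset.univ.filter fun i => z i = 0).card := by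
      exact_mod_cast Finset.card_union_le _ _
    rw [hS] at h2
    linarith
  · intro i hi j hj
    simp only [Finset.mem_compl, Finset.mem_union, Finset.mem_filter, Finset.mem_univ, true_and,
      not_or] at hi hj
    have h := hYz i j
    rw [(hz i).resolve_left hi.2, (hz j).resolve_left hj.2] at h
    simpa [adjMat, hag i j hi.1 hj.1] using h

/-- Coarse identifiability for a graph whose total degree concentrates and in which small sets of
nodes carry few edges. -/
lemma dbar_bounds_of_regular {n : ℕ} (hn : 0 < n) {A A₀ : Fin n → Fin n → Bool} {η R d : ℝ}
    (hηR : η * Real.log (1 / η) * R ≤ 1 / 1000) (hA₀ : IsGraph A₀)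
    (hlow : 9 / 10 * (n * d) ≤ ∑ i, rowSum (adjMat A₀) i)
    (hupp : ∑ i, rowSum (adjMat A₀) i ≤ 11 / 10 * (n * d))
    (hsmall : ∀ U : Finset (Fin n), (U.card : ℝ) ≤ 3 * η * n →
      ∑ i ∈ U, rowSum (adjMat A₀) i ≤ 1 / 10 * (n * d))
    {Y : Matrix (Fin n) (Fin n) ℝ} {z : Fin n → ℝ}
    (hlog : 0 ≤ Real.log (1 / η) * R)
    (hdist : (nodeDist A A₀ : ℝ) ≤ η * n) (hP : P1 (adjMat A) (2 * η) Y z)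
    (hY : ∀ i, rowSum Y i ≤ 2 * Real.log (1 / η) * R * dbar Y) :
    d / 2 ≤ dbar Y ∧ dbar Y ≤ 3 / 2 * d := by
  obtain ⟨U, hU, hag⟩ := exists_agreement_set hdist hP
  obtain ⟨-, -, hYs, hY01, -⟩ := hP
  have hn' : (0 : ℝ) < n := by exact_mod_cast hn
  have hTT : ∑ i ∈ Uᶜ, ∑ j ∈ Uᶜ, Y i j = ∑ i ∈ Uᶜ, ∑ j ∈ Uᶜ, adjMat A₀ i j :=
    Finset.sum_congr rfl fun i hi => Finset.sum_congr rfl fun j hj => hag i hi j hj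
  have hA0 : ∀ i j, 0 ≤ adjMat A₀ i j := fun i j => by
    simp only [adjMat, Matrix.of_apply]; split_ifs <;> norm_num
  have h1 := sum_le_sum_compl_add (adjMat A₀) (fun i j => by simp [adjMat, hA₀.1 i j]) hA0 U
  have h2 := sum_sum_compl_le (adjMat A₀) hA0 U
  have h3 := sum_le_sum_compl_add Y hYs (fun i j => (hY01 i j).1) U
  have h4 := sum_sum_compl_le Y (fun i j => (hY01 i j).1) U
  have hYn : ∑ i, rowSum Y i = n * dbar Y := by
    simp only [dbar, rowSum]; field_simp
  have hd0 : 0 ≤ dbar Y :=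
    div_nonneg (Finset.sum_nonneg fun i _ => Finset.sum_nonneg fun j _ => (hY01 i j).1) hn'.le
  have h5 : ∑ i ∈ U, rowSum Y i ≤ 6 / 1000 * (n * dbar Y) := by
    calc ∑ i ∈ U, rowSum Y i ≤ ∑ i ∈ U, 2 * Real.log (1 / η) * R * dbar Y :=
          Finset.sum_le_sum fun i _ => hY i
      _ = U.card * (2 * (Real.log (1 / η) * R) * dbar Y) := by
          rw [Finset.sum_const, nsmul_eq_mul]; ring
      _ ≤ (3 * η * n) * (2 * (Real.log (1 / η) * R) * dbar Y) := by gcongr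
      _ = 6 * (η * Real.log (1 / η) * R) * (n * dbar Y) := by ring
      _ ≤ 6 * (1 / 1000) * (n * dbar Y) := by gcongr
      _ = 6 / 1000 * (n * dbar Y) := by ring
  have h6 := hsmall U hU
  rw [hYn] at h3 h4
  constructor
  · have : (n : ℝ) * (d / 2) ≤ n * dbar Y := by nlinarith [mul_nonneg hn'.le hd0]
    exact le_of_mul_le_mul_left this hn'
  · have : (n : ℝ) * dbar Y ≤ n * (3 / 2 * d) := by nlinarith [mul_nonneg hn'.le hd0]
    exact le_of_mul_le_mul_left this hn'

lemma erExp_add {n : ℕ} (Q : Matrix (Fin n) (Fin n) ℝ) (X X' : (Fin n → Fin n → Bool) → ℝ) :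
    erExp Q (fun A => X A + X' A) = erExp Q X + erExp Q X' := by
  simp only [erExp, mul_add, Finset.sum_add_distrib]

lemma erExp_sum {n : ℕ} {ι : Type*} (Q : Matrix (Fin n) (Fin n) ℝ) (F : Finset ι)
    (X : ι → (Fin n → Fin n → Bool) → ℝ) :
    erExp Q (fun A => ∑ k ∈ F, X k A) = ∑ k ∈ F, erExp Q (X k) := by
  simp only [erExp, Finset.mul_sum]
  exact Finset.sum_comm

/-- Exponential moment controlling the upper tail of the total degree. -/
lemma erExp_upper_le {n : ℕ} {Q : Matrix (Fin n) (Fin n) ℝ}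
    (hsymm : ∀ i j, Q i j = Q j i) (hdiag : ∀ i, Q i i = 0)
    (hQ : ∀ i j, 0 ≤ Q i j ∧ Q i j ≤ 1) (m : ℝ) (hm : ∑ i, rowSum Q i = m) :
    erExp Q (fun A => Real.exp (∑ i, 1 / 20 * rowSum (adjMat A) i - 11 / 200 * m))
      ≤ Real.exp (-(m / 500)) := by
  have hexp : Real.exp (1 / 20 + 1 / 20) - 1 ≤ 53 / 50 * (1 / 20 + 1 / 20) := by
    have h := Real.exp_bound' (x := 1 / 20 + 1 / 20) (by norm_num) (by norm_num)
      (n := 3) (by norm_num)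
    norm_num [Finset.sum_range_succ, Nat.factorial] at h ⊢
    linarith
  refine (erExp_exp_le hsymm hdiag hQ (fun _ => 1 / 20) (53 / 50) _ fun _ _ => hexp).trans
    (le_of_eq ?_)
  rw [← Finset.mul_sum, hm]
  congr 1
  ring

/-- Exponential moment controlling the lower tail of the total degree. -/
lemma erExp_lower_le {n : ℕ} {Q : Matrix (Fin n) (Fin n) ℝ}
    (hsymm : ∀ i j, Q i j = Q j i) (hdiag : ∀ i, Q i i = 0)
    (hQ : ∀ i j, 0 ≤ Q i j ∧ Q i j ≤ 1) (m : ℝ) (hm : ∑ i, rowSum Q i = m) :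
    erExp Q (fun A => Real.exp (∑ i, -(1 / 20) * rowSum (adjMat A) i - -(9 / 200 * m)))
      ≤ Real.exp (-(m / 500)) := by
  have hexp : Real.exp (-(1 / 20) + -(1 / 20)) - 1
      ≤ 47 / 50 * (-(1 / 20) + -(1 / 20)) := by
    have h := Real.quadratic_le_exp_of_nonneg (x := 1 / 10) (by norm_num)
    have h2 : Real.exp (-(1 / 20) + -(1 / 20)) ≤ 453 / 500 := by
      rw [show (-(1 / 20) + -(1 / 20) : ℝ) = -(1 / 10) by norm_num, Real.exp_neg,
        inv_le_comm₀ (Real.exp_pos _) (by norm_num)]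
      norm_num at h ⊢
      linarith
    linarith
  refine (erExp_exp_le hsymm hdiag hQ (fun _ => -(1 / 20)) (47 / 50) _ fun _ _ => hexp).trans
    (le_of_eq ?_)
  rw [← Finset.mul_sum, hm]
  congr 1
  ring

/-- Exponential moment controlling the total degree of a set of nodes. -/
lemma erExp_degree_le {n : ℕ} {Q : Matrix (Fin n) (Fin n) ℝ}
    (hsymm : ∀ i j, Q i j = Q j i) (hdiag : ∀ i, Q i i = 0)
    (hQ : ∀ i j, 0 ≤ Q i j ∧ Q i j ≤ 1) (D s : ℝ) (hD : ∀ i, rowSum Q i ≤ D)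
    (U : Finset (Fin n)) :
    erExp Q (fun A => Real.exp (∑ i ∈ U, rowSum (adjMat A) i - s))
      ≤ Real.exp (4 * (U.card * D) - s) := by
  have he : Real.exp 1 ≤ 2.72 := by linarith [Real.exp_one_lt_d9]
  have he2 : Real.exp (1 + 1) ≤ 9 := by
    rw [Real.exp_add]
    nlinarith [Real.exp_pos 1]
  have hmom := erExp_exp_le hsymm hdiag hQ (fun i => if i ∈ U then 1 else 0) 4 s (by
    intro i j
    split_ifs
    · linarith
    · rw [add_zero]; linarith
    · rw [zero_add]; linarith
    · simp)
  simp only [ite_mul, one_mul, zero_mul, Finset.sum_ite_mem, Finset.univ_inter] at hmom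
  refine hmom.trans (Real.exp_le_exp.2 ?_)
  have : ∑ i ∈ U, rowSum Q i ≤ U.card * D := by
    simpa using Finset.sum_le_card_nsmul U _ D fun i _ => hD i
  linarith

/-- coarse identifiability for inhomogeneous random graphs:
any feasible solution has average degree within a constant factor of `d°`. -/
theorem coarse_identifiability_whp :
    ∃ c > (0 : ℝ), ∃ c' > (0 : ℝ), ∃ C > (0 : ℝ), ∃ N : ℕ, ∀ n ≥ N,
      ∀ (Q : Matrix (Fin n) (Fin n) ℝ) (R η : ℝ),
        (∀ i j, Q i j = Q j i) → (∀ i, Q i i = 0) →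
        (∀ i j, 0 ≤ Q i j ∧ Q i j ≤ 1) →
        C ≤ dbar Q → 1 ≤ R → (∀ i j, Q i j ≤ R * dbar Q / n) →
        5 ≤ R * dbar Q →
        0 < η → η < 1 / Real.exp 1 → η * Real.log (1 / η) * R ≤ c →
        1 - (n : ℝ) ^ (-c' : ℝ) ≤
          erProb Q (fun A₀ =>
            ∀ A : Fin n → Fin n → Bool, IsGraph A →
              (nodeDist A A₀ : ℝ) ≤ η * n →
              ∀ (Y : Matrix (Fin n) (Fin n) ℝ) (z : Fin n → ℝ),
                P1 (adjMat A) (2 * η) Y z →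
                (∀ i, rowSum Y i ≤ 2 * Real.log (1 / η) * R * dbar Y) →
                dbar Q / 2 ≤ dbar Y ∧ dbar Y ≤ 3 / 2 * dbar Q) := by
  refine ⟨1 / 1000, by norm_num, 1, one_pos, 10000, by norm_num, 1, ?_⟩
  intro n hn Q R η hsymm hdiag hQ hC hR hQR _ hη hηe hηR
  have hn' : (1 : ℝ) ≤ n := by exact_mod_cast hn
  have hL : 1 ≤ Real.log (1 / η) := by
    rw [Real.le_log_iff_exp_le (by positivity), le_div_comm₀ (Real.exp_pos _) hη]
    exact hηe.le
  set L := Real.log (1 / η)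
  set m : ℝ := n * dbar Q with hm
  have hmsum : ∑ i, rowSum Q i = m := by
    simp only [hm, dbar, rowSum]; field_simp
  have hD : ∀ i, rowSum Q i ≤ R * dbar Q := by
    intro i
    calc rowSum Q i ≤ ∑ _j : Fin n, R * dbar Q / n := Finset.sum_le_sum fun j _ => hQR i j
      _ = R * dbar Q := by
        rw [Finset.sum_const, Finset.card_univ, Fintype.card_fin, nsmul_eq_mul]
        field_simp
  let F := Finset.univ.filter fun U : Finset (Fin n) => (U.card : ℝ) ≤ 3 * η * n
  let X₁ : (Fin n → Fin n → Bool) → ℝ := fun A =>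
    Real.exp (∑ i, 1 / 20 * rowSum (adjMat A) i - 11 / 200 * m)
  let X₂ : (Fin n → Fin n → Bool) → ℝ := fun A =>
    Real.exp (∑ i, -(1 / 20) * rowSum (adjMat A) i - -(9 / 200 * m))
  let X₃ : Finset (Fin n) → (Fin n → Fin n → Bool) → ℝ := fun U A =>
    Real.exp (∑ i ∈ U, rowSum (adjMat A) i - 1 / 10 * m)
  have hX₃ : ∀ A, 0 ≤ ∑ U ∈ F, X₃ U A := fun A =>
    Finset.sum_nonneg fun U _ => (Real.exp_pos _).le
  have hmn : (10000 : ℝ) * n ≤ m := by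
    rw [hm]; nlinarith
  have hηR1 : η * R ≤ 1 / 1000 := by
    nlinarith [mul_le_mul_of_nonneg_left hL (by positivity : 0 ≤ η * R)]
  have hηL : η * L ≤ 1 / 1000 := by
    nlinarith [mul_le_mul_of_nonneg_left hR (by positivity : 0 ≤ η * L)]
  have hη1 : η ≤ 1 / 1000 := by nlinarith
  have hm0 : 0 ≤ m := by linarith
  have hsmall : ∑ U ∈ F, erExp Q (X₃ U) ≤ Real.exp (-(m / 500)) := by
    calc ∑ U ∈ F, erExp Q (X₃ U)
        ≤ ∑ U ∈ F, Real.exp (12 * (η * R) * m - 1 / 10 * m) := by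
          refine Finset.sum_le_sum fun U hU => ?_
          refine (erExp_degree_le hsymm hdiag hQ _ _ hD U).trans (Real.exp_le_exp.2 ?_)
          have hU' : (U.card : ℝ) ≤ 3 * η * n := (Finset.mem_filter.1 hU).2
          have hRd : 0 ≤ R * dbar Q := by nlinarith
          have := mul_le_mul_of_nonneg_right hU' hRd
          have hre : 3 * η * n * (R * dbar Q) = 3 * (η * R) * m := by rw [hm]; ring
          linarith
      _ = F.card * Real.exp (12 * (η * R) * m - 1 / 10 * m) := by
          rw [Finset.sum_const, nsmul_eq_mul]
      _ ≤ Real.exp (3 * η * n * L + n * η) * Real.exp (12 * (η * R) * m - 1 / 10 * m) := by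
          refine mul_le_mul_of_nonneg_right ?_ (Real.exp_pos _).le
          exact card_small_subsets_le n _ η hη (by linarith)
      _ ≤ Real.exp (-(m / 500)) := by
          rw [← Real.exp_add, Real.exp_le_exp]
          have h1 := mul_le_mul_of_nonneg_right hηR1 hm0
          have h2 := mul_le_mul_of_nonneg_right hηL (by linarith : (0 : ℝ) ≤ n)
          have h3 := mul_le_mul_of_nonneg_right hη1 (by linarith : (0 : ℝ) ≤ n)
          nlinarith
  have hfail : 3 * Real.exp (-(m / 500)) ≤ (n : ℝ) ^ (-1 : ℝ) := by
    rw [Real.rpow_neg_one, Real.exp_neg, ← div_eq_mul_inv, ← one_div,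
      div_le_div_iff₀ (Real.exp_pos _) (by linarith)]
    linarith [Real.add_one_le_exp (m / 500)]
  have hmark := one_sub_erExp_le_erProb (X := fun A => X₁ A + X₂ A + ∑ U ∈ F, X₃ U A) hQ
    (E := fun A₀ => ∀ A : Fin n → Fin n → Bool, IsGraph A → (nodeDist A A₀ : ℝ) ≤ η * n →
      ∀ (Y : Matrix (Fin n) (Fin n) ℝ) (z : Fin n → ℝ), P1 (adjMat A) (2 * η) Y z →
        (∀ i, rowSum Y i ≤ 2 * L * R * dbar Y) →
        dbar Q / 2 ≤ dbar Y ∧ dbar Y ≤ 3 / 2 * dbar Q)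
    (fun A => add_nonneg (add_nonneg (Real.exp_pos _).le (Real.exp_pos _).le) (hX₃ A)) ?_
  · rw [erExp_add, erExp_add, erExp_sum] at hmark
    have h1 := erExp_upper_le hsymm hdiag hQ m hmsum
    have h2 := erExp_lower_le hsymm hdiag hQ m hmsum
    linarith
  · intro A₀ hA₀ hX A _ hdist Y z hP hY
    have hp₁ : 0 < X₁ A₀ := Real.exp_pos _
    have hp₂ : 0 < X₂ A₀ := Real.exp_pos _
    have hp₃ := hX₃ A₀
    have h1 : X₁ A₀ < 1 := by linarith
    have h2 : X₂ A₀ < 1 := by linarith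
    have h3 : ∑ U ∈ F, X₃ U A₀ < 1 := by linarith
    have h1' := Real.exp_lt_one_iff.1 h1
    have h2' := Real.exp_lt_one_iff.1 h2
    rw [← Finset.mul_sum] at h1' h2'
    refine dbar_bounds_of_regular hn hηR hA₀ (by linarith) (by linarith) (fun U hU => ?_)
      (by positivity) hdist hP hY
    have h4 : X₃ U A₀ ≤ ∑ U ∈ F, X₃ U A₀ :=
      Finset.single_le_sum (f := fun U => X₃ U A₀) (fun U _ => (Real.exp_pos _).le)
        (Finset.mem_filter.2 ⟨Finset.mem_univ _, hU⟩)
    have h5 := Real.exp_lt_one_iff.1 (h4.trans_lt h3)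
    linarith

end EdgeDensity
end

section
/- Let n ∈ ℕ, let A ∈ ℝ^{n×n} be symmetric, let σ, d̂ ≥ 0, and let γ, γ* ∈ [0,1]. Suppose there exists a pair (A*, z*) satisfying the feasibility constraints P1(A, γ*) such that (A*·𝟙)_i ≤ σ·d̂ for all i. Then every pair (Y, z) satisfying P1(A, γ) with (Y·𝟙)_i ≤ σ·d̂ for all i obeys |d(Y) − d(A*)| ≤ 2·(γ+γ*)·σ·d̂. -/
open scoped BigOperators Classical

namespace EdgeDensity

/-- One-sided comparison of the average degrees of two feasible matrices. -/
lemma P1.dbar_sub_le {n : ℕ} {A Y B : Matrix (Fin n) (Fin n) ℝ} {γ δ D : ℝ} {z w : Fin n → ℝ}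
    (hγ : 0 ≤ γ) (hδ : 0 ≤ δ) (hD : 0 ≤ D) (hY : P1 A γ Y z) (hB : P1 A δ B w)
    (hdeg : ∀ i, rowSum Y i ≤ D) :
    dbar Y - dbar B ≤ 2 * (γ + δ) * D := by
  obtain ⟨hz, hzsum, hYsymm, hY01, hYA⟩ := hY
  obtain ⟨hw, hwsum, -, hB01, hBA⟩ := hB
  set u : Fin n → ℝ := fun i => (1 - z i) + (1 - w i) with hu
  have hu0 (i) : 0 ≤ u i := by
    rcases hz i with h | h <;> rcases hw i with h' | h' <;> norm_num [hu, h, h']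
  have husum : ∑ i, u i ≤ (γ + δ) * n := by
    simp only [hu, Finset.sum_add_distrib, Finset.sum_sub_distrib, Finset.sum_const,
      Finset.card_univ, Fintype.card_fin, nsmul_eq_mul, mul_one]
    linarith
  have hentry (i j) : Y i j ≤ B i j + u i * Y i j + u j * Y j i := by
    have hYij := (hY01 i j).1
    have hBij := (hB01 i j).1
    have hYA' := hYA i j
    have hBA' := hBA i j
    rw [hYsymm j i]
    rcases hz i with h1 | h1 <;> rcases hw i with h2 | h2 <;> rcases hz j with h3 | h3 <;>
      rcases hw j with h4 | h4 <;> simp only [hu, h1, h2, h3, h4] at hYA' hBA' ⊢ <;> linarith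
  have hrow : ∑ i, ∑ j, u i * Y i j ≤ (γ + δ) * n * D := by
    calc ∑ i, ∑ j, u i * Y i j = ∑ i, u i * rowSum Y i := by
          simp only [rowSum, Finset.mul_sum]
      _ ≤ ∑ i, u i * D := Finset.sum_le_sum fun i _ =>
          mul_le_mul_of_nonneg_left (hdeg i) (hu0 i)
      _ = (∑ i, u i) * D := by rw [Finset.sum_mul]
      _ ≤ (γ + δ) * n * D := mul_le_mul_of_nonneg_right husum hD
  have htotal : ∑ i, ∑ j, Y i j ≤ ∑ i, ∑ j, B i j + 2 * ((γ + δ) * n * D) := by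
    have h := Finset.sum_le_sum fun i (_ : i ∈ Finset.univ) =>
      Finset.sum_le_sum fun j (_ : j ∈ Finset.univ) => hentry i j
    simp only [Finset.sum_add_distrib] at h
    rw [Finset.sum_comm (f := fun i j => u j * Y j i)] at h
    linarith
  rw [dbar, dbar, ← sub_div]
  refine div_le_of_le_mul₀ n.cast_nonneg (by positivity) ?_
  linarith

/-- fine identifiability for inhomogeneous random graphs
under an absolute degree bound. -/
theorem fine_identifiability_inhomo (n : ℕ) (A : Matrix (Fin n) (Fin n) ℝ)
    (hA : ∀ i j, A i j = A j i)
    (σ dhat γ γs : ℝ) (hσ : 0 ≤ σ) (hdhat : 0 ≤ dhat)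
    (hγ0 : 0 ≤ γ) (hγ1 : γ ≤ 1) (hγs0 : 0 ≤ γs) (hγs1 : γs ≤ 1)
    (Astar : Matrix (Fin n) (Fin n) ℝ) (zstar : Fin n → ℝ)
    (hfeas : P1 A γs Astar zstar)
    (hdeg : ∀ i, rowSum Astar i ≤ σ * dhat)
    (Y : Matrix (Fin n) (Fin n) ℝ) (z : Fin n → ℝ)
    (hY : P1 A γ Y z)
    (hYdeg : ∀ i, rowSum Y i ≤ σ * dhat) :
    |dbar Y - dbar Astar| ≤ 2 * (γ + γs) * σ * dhat := by
  have hD : 0 ≤ σ * dhat := mul_nonneg hσ hdhat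
  have h₁ := P1.dbar_sub_le hγ0 hγs0 hD hY hfeas hYdeg
  have h₂ := P1.dbar_sub_le hγs0 hγ0 hD hfeas hY hdeg
  rw [abs_le]
  constructor <;> linarith

end EdgeDensity
end

section
/- There exist absolute constants c, c' > 0 such that the following holds for all sufficiently large n. Let Q° ∈ [0,1]^{n×n} be symmetric with zero diagonal, let d° := d(Q°) ≥ 1, let R ≥ 1 satisfy Q°_ij ≤ R·d°/n for all i,j and R·d° ≥ 5, and let η ∈ (0, 1/e) satisfy η·log(1/η)·R ≤ c. Then with probability at least 1 − n^{−c'} over a random graph A° drawn from G(n,Q°), the following holds: for every n-node graph A with dist(A, A°) ≤ η·n and every d̂ ≥ d°/2, there exist an n-node graph A* and z* ∈ {0,1}^n such that (i) |d(A*) − d°| ≤ 10·√(d°·log n/n) + 2·η·log(1/η)·R·d°, and (ii) (A*, z*) satisfies the feasibility constraints P1(A, 2η) and (A*·𝟙)_i ≤ 10·log(1/η)·R·d̂ for all i. -/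
open scoped BigOperators Classical

namespace EdgeDensity

/-- The pairs `(i, j)` with `i < j`. -/
def orderedPairs (n : ℕ) : Finset (Fin n × Fin n) :=
  Finset.univ.filter fun p => p.1 < p.2

lemma sum_sum_eq_sum_orderedPairs {n : ℕ} (f : Fin n → Fin n → ℝ) (hf : ∀ i, f i i = 0) :
    ∑ i, ∑ j, f i j = ∑ p ∈ orderedPairs n, (f p.1 p.2 + f p.2 p.1) := by
  have hswap : ∑ p ∈ orderedPairs n, f p.2 p.1 =
      ∑ p ∈ Finset.univ.filter (fun p : Fin n × Fin n => p.2 < p.1), f p.1 p.2 := by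
    refine Finset.sum_nbij' Prod.swap Prod.swap ?_ ?_ ?_ ?_ ?_ <;> simp [orderedPairs]
  rw [Finset.sum_add_distrib, hswap, ← Fintype.sum_prod_type', orderedPairs, Finset.sum_filter,
    Finset.sum_filter, ← Finset.sum_add_distrib]
  refine Finset.sum_congr rfl fun p _ => ?_
  rcases lt_trichotomy p.1 p.2 with h | h | h
  · simp [h, h.not_gt]
  · simp [h, hf]
  · simp [h, h.not_gt]

lemma erWeight_eq_prod_orderedPairs {n : ℕ} (Q : Matrix (Fin n) (Fin n) ℝ)
    (A : Fin n → Fin n → Bool) :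
    erWeight Q A = ∏ p ∈ orderedPairs n, (if A p.1 p.2 then Q p.1 p.2 else 1 - Q p.1 p.2) := by
  simp only [erWeight, orderedPairs, Finset.prod_filter]
  rw [Fintype.prod_prod_type]

/-- The moment generating function of a linear statistic of `G(n,Q)`. -/
lemma sum_erWeight_mul_exp {n : ℕ} (Q : Matrix (Fin n) (Fin n) ℝ) (w : Fin n × Fin n → ℝ) :
    ∑ A ∈ Finset.univ.filter (fun A : Fin n → Fin n → Bool => IsGraph A),
      erWeight Q A * Real.exp (∑ p ∈ orderedPairs n, w p * adjMat A p.1 p.2) =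
    ∏ p ∈ orderedPairs n, (Q p.1 p.2 * Real.exp (w p) + (1 - Q p.1 p.2)) := by
  rw [Finset.prod_add]
  refine Finset.sum_nbij' (fun A => (orderedPairs n).filter fun p => A p.1 p.2 = true)
    (fun t i j => decide ((i, j) ∈ t ∨ (j, i) ∈ t)) ?_ ?_ ?_ ?_ ?_
  · intro A _
    simp
  · intro t ht
    have ht' : ∀ p ∈ t, p.1 < p.2 := fun p hp => by
      simpa [orderedPairs] using Finset.mem_powerset.1 ht hp
    simp only [Finset.mem_filter, Finset.mem_univ, true_and]
    refine ⟨fun i j => by simp [or_comm], fun i => ?_⟩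
    simpa using fun h => lt_irrefl _ (ht' _ h)
  · intro A hA
    obtain ⟨hs, hd⟩ := (Finset.mem_filter.1 hA).2
    funext i j
    rcases lt_trichotomy i j with h | h | h
    · simp [orderedPairs, h, h.not_gt]
    · subst h
      simp [orderedPairs, hd]
    · simp [orderedPairs, h, h.not_gt, hs i j]
  · intro t ht
    have ht' : ∀ p ∈ t, p.1 < p.2 := fun p hp => by
      simpa [orderedPairs] using Finset.mem_powerset.1 ht hp
    ext ⟨i, j⟩
    simp only [orderedPairs, Finset.mem_filter, Finset.mem_univ, true_and, decide_eq_true_eq]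
    constructor
    · rintro ⟨h, h' | h'⟩
      · exact h'
      · exact absurd (ht' _ h') h.not_gt
    · exact fun h => ⟨ht' _ h, Or.inl h⟩
  · intro A _
    rw [erWeight_eq_prod_orderedPairs, Real.exp_sum, ← Finset.prod_mul_distrib,
      ← Finset.filter_not, ← Finset.prod_ite]
    refine Finset.prod_congr rfl fun p _ => ?_
    by_cases h : A p.1 p.2 = true <;> simp [h, adjMat]

lemma sum_erWeight_mul_exp_le {n : ℕ} {Q : Matrix (Fin n) (Fin n) ℝ}
    (hQ : ∀ i j, 0 ≤ Q i j ∧ Q i j ≤ 1) (w : Fin n × Fin n → ℝ) (t B : ℝ)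
    (hB : ∑ p ∈ orderedPairs n, Q p.1 p.2 * (Real.exp (w p) - 1) ≤ B) :
    ∑ A ∈ Finset.univ.filter (fun A : Fin n → Fin n → Bool => IsGraph A),
      erWeight Q A * Real.exp (∑ p ∈ orderedPairs n, w p * adjMat A p.1 p.2 - t) ≤
    Real.exp (B - t) := by
  have hmgf : ∏ p ∈ orderedPairs n, (Q p.1 p.2 * Real.exp (w p) + (1 - Q p.1 p.2)) ≤
      Real.exp B := by
    refine le_trans ?_ (Real.exp_le_exp.2 hB)
    rw [Real.exp_sum]
    refine Finset.prod_le_prod (fun p _ => ?_) fun p _ => ?_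
    · have := hQ p.1 p.2
      have := mul_nonneg this.1 (Real.exp_pos (w p)).le
      linarith
    · have := Real.add_one_le_exp (Q p.1 p.2 * (Real.exp (w p) - 1))
      linarith
  rw [← sum_erWeight_mul_exp] at hmgf
  simp only [Real.exp_sub, ← mul_div_assoc, ← Finset.sum_div]
  gcongr

/-- A Chernoff-type union bound: if `E` holds whenever every exponent `F a` is nonpositive, its
failure probability is at most the sum of the exponential moments. -/
lemma one_sub_le_erProb {n : ℕ} {Q : Matrix (Fin n) (Fin n) ℝ}
    (hQ : ∀ i j, 0 ≤ Q i j ∧ Q i j ≤ 1) {ι : Type*} (s : Finset ι)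
    (F : ι → (Fin n → Fin n → Bool) → ℝ) (b : ι → ℝ) (E : (Fin n → Fin n → Bool) → Prop)
    (hF : ∀ a ∈ s, ∑ A ∈ Finset.univ.filter (fun A : Fin n → Fin n → Bool => IsGraph A),
      erWeight Q A * Real.exp (F a A) ≤ b a)
    (hE : ∀ A, IsGraph A → (∀ a ∈ s, F a A ≤ 0) → E A) :
    1 - ∑ a ∈ s, b a ≤ erProb Q E := by
  have hexp : ∑ A ∈ Finset.univ.filter (fun A : Fin n → Fin n → Bool => IsGraph A),
      erWeight Q A * ∑ a ∈ s, Real.exp (F a A) ≤ ∑ a ∈ s, b a := by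
    simp only [Finset.mul_sum]
    rw [Finset.sum_comm]
    exact Finset.sum_le_sum hF
  have hpt : ∑ A ∈ Finset.univ.filter (fun A : Fin n → Fin n → Bool => IsGraph A),
      (erWeight Q A - erWeight Q A * ∑ a ∈ s, Real.exp (F a A)) ≤ erProb Q E := by
    rw [erProb, ← Finset.filter_filter, Finset.sum_filter (p := E)]
    refine Finset.sum_le_sum fun A hA => ?_
    have hw := erWeight_nonneg hQ A
    split_ifs with h
    · have : 0 ≤ ∑ a ∈ s, Real.exp (F a A) := Finset.sum_nonneg fun a _ => (Real.exp_pos _).le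
      nlinarith
    · have : ∃ a ∈ s, 0 < F a A := by
        by_contra! hcon
        exact h (hE A (Finset.mem_filter.1 hA).2 hcon)
      obtain ⟨a, ha, hpos⟩ := this
      have h1 : Real.exp (F a A) ≤ ∑ a ∈ s, Real.exp (F a A) :=
        Finset.single_le_sum (f := fun a => Real.exp (F a A)) (fun _ _ => (Real.exp_pos _).le) ha
      have h2 := Real.one_le_exp hpos.le
      nlinarith
  rw [Finset.sum_sub_distrib, sum_erWeight] at hpt
  linarith

lemma adjMat_nonneg {n : ℕ} (A : Fin n → Fin n → Bool) (i j : Fin n) : 0 ≤ adjMat A i j := by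
  simp only [adjMat, Matrix.of_apply]
  split_ifs <;> norm_num

lemma adjMat_diag {n : ℕ} {A : Fin n → Fin n → Bool} (hA : IsGraph A) (i : Fin n) :
    adjMat A i i = 0 := by
  simp [adjMat, hA.2]

lemma adjMat_symm {n : ℕ} {A : Fin n → Fin n → Bool} (hA : IsGraph A) (i j : Fin n) :
    adjMat A i j = adjMat A j i := by
  simp [adjMat, hA.1 i j]

lemma natCast_mul_dbar {n : ℕ} (M : Matrix (Fin n) (Fin n) ℝ) :
    n * dbar M = ∑ i, ∑ j, M i j := by
  rcases Nat.eq_zero_or_pos n with rfl | hn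
  · simp
  · have : (n : ℝ) ≠ 0 := by positivity
    rw [dbar, mul_div_cancel₀ _ this]

lemma natCast_mul_dbar_eq_two_mul {n : ℕ} {M : Matrix (Fin n) (Fin n) ℝ}
    (hs : ∀ i j, M i j = M j i) (hd : ∀ i, M i i = 0) :
    n * dbar M = 2 * ∑ p ∈ orderedPairs n, M p.1 p.2 := by
  rw [natCast_mul_dbar, sum_sum_eq_sum_orderedPairs _ hd, Finset.mul_sum]
  exact Finset.sum_congr rfl fun p _ => by rw [hs p.2 p.1]; ring

lemma sum_rowSum_eq_sum_orderedPairs {n : ℕ} {M : Matrix (Fin n) (Fin n) ℝ}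
    (hs : ∀ i j, M i j = M j i) (hd : ∀ i, M i i = 0) (T : Finset (Fin n)) :
    ∑ i ∈ T, rowSum M i = ∑ p ∈ orderedPairs n,
      ((if p.1 ∈ T then 1 else 0) + (if p.2 ∈ T then 1 else 0)) * M p.1 p.2 := by
  have h : ∑ i ∈ T, rowSum M i = ∑ i, ∑ j, (if i ∈ T then 1 else 0) * M i j := by
    simp [rowSum, Finset.sum_ite_mem]
  rw [h, sum_sum_eq_sum_orderedPairs _ fun i => by rw [hd, mul_zero]]
  exact Finset.sum_congr rfl fun p _ => by rw [hs p.2 p.1]; ring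

lemma sum_erWeight_mul_exp_dbar_le {n : ℕ} {Q : Matrix (Fin n) (Fin n) ℝ}
    (hs : ∀ i j, Q i j = Q j i) (hd : ∀ i, Q i i = 0)
    (hQ : ∀ i j, 0 ≤ Q i j ∧ Q i j ≤ 1) {x : ℝ} (hx : |x| ≤ 1) :
    ∑ A ∈ Finset.univ.filter (fun A : Fin n → Fin n → Bool => IsGraph A),
      erWeight Q A * Real.exp (x * (n * dbar (adjMat A) - n * dbar Q) / 2 - n * dbar Q * x ^ 2) ≤
    Real.exp (-(n * dbar Q * x ^ 2 / 2)) := by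
  have hm := natCast_mul_dbar_eq_two_mul hs hd
  have h := sum_erWeight_mul_exp_le hQ (fun _ => x) (x * (n * dbar Q) / 2 + n * dbar Q * x ^ 2)
    ((x + x ^ 2) * (n * dbar Q) / 2) (by
      rw [hm, ← Finset.sum_mul]
      have h1 := (abs_le.1 (Real.abs_exp_sub_one_sub_id_le hx)).2
      have h2 : 0 ≤ ∑ p ∈ orderedPairs n, Q p.1 p.2 := Finset.sum_nonneg fun p _ => (hQ _ _).1
      nlinarith)
  refine le_trans (le_of_eq (Finset.sum_congr rfl fun A hA => ?_))
    (h.trans (le_of_eq (by congr 1; ring)))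
  have hA := (Finset.mem_filter.1 hA).2
  rw [natCast_mul_dbar_eq_two_mul (adjMat_symm hA) (adjMat_diag hA), ← Finset.mul_sum]
  congr 2
  ring

lemma sum_erWeight_mul_exp_sum_rowSum_le {n : ℕ} {Q : Matrix (Fin n) (Fin n) ℝ}
    (hs : ∀ i j, Q i j = Q j i) (hd : ∀ i, Q i i = 0)
    (hQ : ∀ i j, 0 ≤ Q i j ∧ Q i j ≤ 1) {D : ℝ} (hD : ∀ i, rowSum Q i ≤ D)
    (T : Finset (Fin n)) (t : ℝ) :
    ∑ A ∈ Finset.univ.filter (fun A : Fin n → Fin n → Bool => IsGraph A),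
      erWeight Q A * Real.exp (∑ i ∈ T, rowSum (adjMat A) i - t) ≤
    Real.exp (T.card * (4 * D) - t) := by
  have hT : ∑ i ∈ T, rowSum Q i ≤ T.card * D := by
    simpa using Finset.sum_le_card_nsmul T _ D fun i _ => hD i
  rw [sum_rowSum_eq_sum_orderedPairs hs hd] at hT
  refine le_trans (le_of_eq (Finset.sum_congr rfl fun A hA => ?_))
    (sum_erWeight_mul_exp_le hQ
      (fun p => (if p.1 ∈ T then 1 else 0) + (if p.2 ∈ T then 1 else 0)) t _ ?_)
  · have hA := (Finset.mem_filter.1 hA).2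
    rw [sum_rowSum_eq_sum_orderedPairs (adjMat_symm hA) (adjMat_diag hA)]
  · have he : Real.exp 1 < 3 := by linarith [Real.exp_one_lt_d9]
    have he2 : Real.exp (1 + 1) ≤ 9 := by
      rw [Real.exp_add]
      nlinarith [Real.exp_pos 1]
    have key : ∀ (q : ℝ) (a b : Prop) [Decidable a] [Decidable b], 0 ≤ q →
        q * (Real.exp ((if a then 1 else 0) + (if b then 1 else 0)) - 1) ≤
          4 * (((if a then 1 else 0) + (if b then 1 else 0)) * q) := fun q a b _ _ hq => by
      by_cases ha : a <;> by_cases hb : b <;>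
        simp only [ha, hb, if_true, if_false, add_zero, zero_add, Real.exp_zero] <;> nlinarith
    have hle : ∑ p ∈ orderedPairs n, Q p.1 p.2 * (Real.exp
        ((if p.1 ∈ T then 1 else 0) + (if p.2 ∈ T then 1 else 0)) - 1) ≤
        4 * ∑ p ∈ orderedPairs n,
          ((if p.1 ∈ T then 1 else 0) + (if p.2 ∈ T then 1 else 0)) * Q p.1 p.2 := by
      rw [Finset.mul_sum]
      exact Finset.sum_le_sum fun p _ => key _ _ _ (hQ p.1 p.2).1
    linarith

lemma exists_card_le_of_nodeDist_le {n : ℕ} {A B : Fin n → Fin n → Bool} {r : ℝ}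
    (h : (nodeDist A B : ℝ) ≤ r) :
    ∃ S : Finset (Fin n), (S.card : ℝ) ≤ r ∧ ∀ i j, i ∉ S → j ∉ S → A i j = B i j := by
  have hne : {k | ∃ S : Finset (Fin n), S.card = k ∧
      ∀ i j, i ∉ S → j ∉ S → A i j = B i j}.Nonempty :=
    ⟨_, Finset.univ, rfl, fun i _ hi => absurd (Finset.mem_univ i) hi⟩
  obtain ⟨S, hS, hAB⟩ := Nat.sInf_mem hne
  refine ⟨S, ?_, hAB⟩
  rw [hS]
  exact h

/-- If every `k`-set of nodes has small total degree, then isolating the high-degree nodes of `A₀`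
yields a feasible bounded-degree graph whose average degree is close to that of `A₀`. -/
lemma exists_feasible_of_sum_rowSum_le {n k : ℕ} {A₀ A : Fin n → Fin n → Bool} {η M : ℝ}
    (hA₀ : IsGraph A₀) (hη : 0 ≤ η) (hM : 0 ≤ M)
    (hdist : (nodeDist A A₀ : ℝ) ≤ η * n) (hk : 1 ≤ k) (hkn : k ≤ n)
    (hkη : 1 < k → (k : ℝ) ≤ η * n)
    (hdeg : ∀ T : Finset (Fin n), T.card = k → ∑ i ∈ T, rowSum (adjMat A₀) i ≤ k * M) :
    ∃ (Y : Fin n → Fin n → Bool) (z : Fin n → ℝ), IsGraph Y ∧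
      |dbar (adjMat Y) - dbar (adjMat A₀)| ≤ 2 * η * M ∧
      P1 (adjMat A) (2 * η) (adjMat Y) z ∧ ∀ i, rowSum (adjMat Y) i ≤ M := by
  obtain ⟨S, hS, hAS⟩ := exists_card_le_of_nodeDist_le hdist
  have hn : (0 : ℝ) < n := by exact_mod_cast hk.trans hkn
  have hrow : ∀ i, 0 ≤ rowSum (adjMat A₀) i := fun i =>
    Finset.sum_nonneg fun j _ => adjMat_nonneg _ _ _
  set T : Finset (Fin n) := Finset.univ.filter fun i => M < rowSum (adjMat A₀) i with hTdef
  have hTk : T.card < k := by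
    by_contra! hcon
    obtain ⟨U, hUT, hU⟩ := Finset.exists_subset_card_eq hcon
    have hne : U.Nonempty := Finset.card_pos.1 (by omega)
    have := Finset.sum_lt_sum_of_nonempty hne fun i hi =>
      (Finset.mem_filter.1 (hUT hi)).2
    rw [Finset.sum_const, hU, nsmul_eq_mul] at this
    exact absurd (hdeg U hU) this.not_ge
  have hTη : (T.card : ℝ) ≤ η * n ∧ ∑ i ∈ T, rowSum (adjMat A₀) i ≤ η * n * M := by
    rcases Nat.eq_zero_or_pos T.card with h0 | hpos
    · rw [h0, Finset.card_eq_zero.1 h0]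
      simp only [Nat.cast_zero, Finset.sum_empty]
      exact ⟨by positivity, by positivity⟩
    · have hkη' := hkη (by omega)
      have hTk' : (T.card : ℝ) ≤ k := by exact_mod_cast hTk.le
      obtain ⟨U, hTU, -, hU⟩ := Finset.exists_subsuperset_card_eq (Finset.subset_univ T) hTk.le
        (by simpa using hkn)
      refine ⟨hTk'.trans hkη', ?_⟩
      calc ∑ i ∈ T, rowSum (adjMat A₀) i ≤ ∑ i ∈ U, rowSum (adjMat A₀) i :=
            Finset.sum_le_sum_of_subset_of_nonneg hTU fun i _ _ => hrow i
        _ ≤ k * M := hdeg U hU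
        _ ≤ η * n * M := by gcongr
  let Y : Fin n → Fin n → Bool := fun i j => A₀ i j && decide (i ∉ T) && decide (j ∉ T)
  have hY : IsGraph Y := by
    refine ⟨fun i j => ?_, fun i => ?_⟩
    · simp only [Y, hA₀.1 i j]
      rw [Bool.and_right_comm]
    · simp [Y, hA₀.2]
  have hYle : ∀ i j, adjMat Y i j ≤ adjMat A₀ i j := fun i j => by
    by_cases h : A₀ i j = true <;> by_cases hi : i ∈ T <;> by_cases hj : j ∈ T <;>
      simp [adjMat, Y, h, hi, hj]
  have hleY : ∀ i j, adjMat A₀ i j - adjMat Y i j ≤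
      (if i ∈ T then 1 else 0) * adjMat A₀ i j + (if j ∈ T then 1 else 0) * adjMat A₀ j i :=
    fun i j => by
      rw [adjMat_symm hA₀ j i]
      by_cases h : A₀ i j = true <;> by_cases hi : i ∈ T <;> by_cases hj : j ∈ T <;>
        simp [adjMat, Y, h, hi, hj]
  refine ⟨Y, fun i => if i ∈ S ∪ T then 0 else 1, hY, ?_, ⟨?_, ?_, ?_, ?_, ?_⟩, ?_⟩
  · have hdiff : n * dbar (adjMat A₀) - n * dbar (adjMat Y) =
        ∑ i, ∑ j, (adjMat A₀ i j - adjMat Y i j) := by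
      simp only [natCast_mul_dbar, Finset.sum_sub_distrib]
    have hlow : 0 ≤ n * dbar (adjMat A₀) - n * dbar (adjMat Y) := by
      rw [hdiff]
      exact Finset.sum_nonneg fun i _ => Finset.sum_nonneg fun j _ => sub_nonneg.2 (hYle i j)
    have hup : n * dbar (adjMat A₀) - n * dbar (adjMat Y) ≤
        2 * ∑ i ∈ T, rowSum (adjMat A₀) i := by
      rw [hdiff]
      refine (Finset.sum_le_sum fun i _ => Finset.sum_le_sum fun j _ => hleY i j).trans ?_
      have h : ∑ i, ∑ j, (if i ∈ T then 1 else 0) * adjMat A₀ i j =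
          ∑ i ∈ T, rowSum (adjMat A₀) i := by
        simp [rowSum, Finset.sum_ite_mem]
      simp only [Finset.sum_add_distrib]
      rw [Finset.sum_comm (f := fun i j => (if j ∈ T then 1 else 0) * adjMat A₀ j i), h]
      linarith
    rw [abs_sub_comm, abs_le]
    constructor
    · have : 0 ≤ dbar (adjMat A₀) - dbar (adjMat Y) := by
        rw [← mul_sub] at hlow
        exact nonneg_of_mul_nonneg_right hlow hn
      have : 0 ≤ η * M := by positivity
      linarith
    · refine le_of_mul_le_mul_left ?_ hn
      linarith [hTη.2]
  · intro i
    dsimp only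
    split_ifs <;> simp
  · have hcard : ((S ∪ T).card : ℝ) ≤ S.card + T.card := by
      exact_mod_cast Finset.card_union_le S T
    have hsum : ∑ i : Fin n, (if i ∈ S ∪ T then (0 : ℝ) else 1) = n - (S ∪ T).card := by
      have h : ∀ i : Fin n, (if i ∈ S ∪ T then (0 : ℝ) else 1) =
          1 - (if i ∈ S ∪ T then 1 else 0) := fun i => by split_ifs <;> norm_num
      rw [Finset.sum_congr rfl fun i _ => h i, Finset.sum_sub_distrib, Finset.sum_boole]
      simp only [Finset.filter_univ_mem, Finset.sum_const, Finset.card_univ, Fintype.card_fin,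
        nsmul_eq_mul, mul_one]
    rw [hsum]
    linarith [hTη.1]
  · exact adjMat_symm hY
  · refine fun i j => ⟨adjMat_nonneg _ _ _, ?_⟩
    simp only [adjMat, Matrix.of_apply]
    split_ifs <;> norm_num
  · intro i j
    dsimp only
    by_cases hi : i ∈ S ∪ T
    · simp [hi]
    by_cases hj : j ∈ S ∪ T
    · simp [hj]
    rw [Finset.mem_union, not_or] at hi hj
    simp [adjMat, Y, hi, hj, hAS i j hi.1 hj.1]
  · intro i
    by_cases hi : i ∈ T
    · have : rowSum (adjMat Y) i = 0 := by simp [rowSum, adjMat, Y, hi]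
      rwa [this]
    · have : rowSum (adjMat A₀) i ≤ M := by simpa [hTdef] using hi
      exact (Finset.sum_le_sum fun j _ => hYle i j).trans this

lemma choose_le_exp {n k : ℕ} {x : ℝ} (h : (n : ℝ) ≤ k * Real.exp x) :
    (n.choose k : ℝ) ≤ Real.exp (k * (x + 1)) := by
  calc (n.choose k : ℝ) ≤ (n : ℝ) ^ k / k.factorial := Nat.choose_le_pow_div k n
    _ ≤ (k * Real.exp x) ^ k / k.factorial := by gcongr
    _ = Real.exp x ^ k * ((k : ℝ) ^ k / k.factorial) := by ring
    _ ≤ Real.exp x ^ k * Real.exp k := by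
        gcongr
        exact Real.pow_div_factorial_le_exp _ (Nat.cast_nonneg _) _
    _ = Real.exp (k * (x + 1)) := by
        rw [← Real.exp_nat_mul, ← Real.exp_add]
        congr 1
        ring

/-- The union bound over all `k`-sets of nodes. -/
lemma choose_mul_exp_le_inv {n : ℕ} {η D : ℝ} (hn : 1 ≤ n) (hη : 0 < η)
    (hℓ : 20 ≤ Real.log (1 / η)) (hD : 5 ≤ D) {k : ℕ} (hk : 1 ≤ k) (hkη : η * n ≤ 2 * k) :
    n.choose k * Real.exp (k * (4 * D) - k * (Real.log (1 / η) * D)) ≤ (n : ℝ)⁻¹ := by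
  set ℓ := Real.log (1 / η) with hℓdef
  have hn0 : (0 : ℝ) < n := by exact_mod_cast hn
  have hk1 : (1 : ℝ) ≤ k := by exact_mod_cast hk
  have heℓ : Real.exp ℓ = 1 / η := Real.exp_log (by positivity)
  have hchoose : (n.choose k : ℝ) ≤ Real.exp (k * (1 + ℓ + 1)) := by
    refine choose_le_exp ?_
    have h2 : 2 ≤ Real.exp 1 := by linarith [Real.add_one_le_exp (1 : ℝ)]
    rw [Real.exp_add, heℓ]
    have : (n : ℝ) ≤ k * (2 * (1 / η)) := by
      rw [mul_one_div, ← mul_div_assoc, le_div_iff₀ hη]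
      linarith
    refine this.trans ?_
    gcongr
  have hlog : Real.log n ≤ 2 * (k * ℓ) := by
    by_cases hs : η * Real.sqrt n ≤ 1
    · have h : Real.log (Real.sqrt n) ≤ ℓ := by
        refine Real.log_le_log (Real.sqrt_pos.2 hn0) ?_
        rw [le_div_iff₀ hη]
        linarith
      rw [Real.log_sqrt hn0.le] at h
      nlinarith
    · have h1 := Real.log_le_sub_one_of_pos (Real.sqrt_pos.2 hn0)
      rw [Real.log_sqrt hn0.le] at h1
      have h2 : Real.sqrt n ≤ η * n := by
        have := Real.mul_self_sqrt hn0.le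
        nlinarith [Real.sqrt_pos.2 hn0]
      nlinarith
  have hexp : k * (1 + ℓ + 1) + (k * (4 * D) - k * (ℓ * D)) ≤ -Real.log n := by
    have h : (1 + ℓ + 1) + (4 * D - ℓ * D) ≤ -(2 * ℓ) := by nlinarith
    nlinarith
  calc n.choose k * Real.exp (k * (4 * D) - k * (ℓ * D))
      ≤ Real.exp (k * (1 + ℓ + 1)) * Real.exp (k * (4 * D) - k * (ℓ * D)) := by gcongr
    _ ≤ Real.exp (-Real.log n) := by
        rw [← Real.exp_add]
        exact Real.exp_le_exp.2 hexp
    _ = (n : ℝ)⁻¹ := by rw [Real.exp_neg, Real.exp_log hn0]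

lemma exists_nat_of_mul_le {n : ℕ} {η : ℝ} (hn : 1 ≤ n) (hη : 0 ≤ η) (hη1 : η ≤ 1) :
    ∃ k : ℕ, 1 ≤ k ∧ k ≤ n ∧ (1 < k → (k : ℝ) ≤ η * n) ∧ η * n ≤ 2 * k := by
  have h0 : 0 ≤ η * n := by positivity
  refine ⟨max 1 ⌊η * n⌋₊, le_max_left _ _, max_le hn ?_, fun h => ?_, ?_⟩
  · refine Nat.floor_le_of_le ?_
    exact mul_le_of_le_one_left (Nat.cast_nonneg _) hη1
  · rw [max_eq_right (by simpa using ((lt_max_iff.1 h).resolve_left (lt_irrefl 1)).le)]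
    exact Nat.floor_le h0
  · have h1 := Nat.lt_floor_add_one (η * n)
    have h2 : (1 : ℝ) ≤ (max 1 ⌊η * n⌋₊ : ℕ) := by exact_mod_cast le_max_left _ _
    have h3 : (⌊η * n⌋₊ : ℝ) ≤ (max 1 ⌊η * n⌋₊ : ℕ) := by exact_mod_cast le_max_right _ _
    linarith

/-- With high probability the average degree concentrates and all `k`-sets of nodes have small
total degree. -/
lemma one_sub_le_erProb_of_typical {n k : ℕ} {Q : Matrix (Fin n) (Fin n) ℝ}
    (hs : ∀ i j, Q i j = Q j i) (hd : ∀ i, Q i i = 0)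
    (hQ : ∀ i j, 0 ≤ Q i j ∧ Q i j ≤ 1) {D x M : ℝ} (hD : ∀ i, rowSum Q i ≤ D)
    (hx0 : 0 < x) (hx1 : x ≤ 1) (hn : 0 < n) (E : (Fin n → Fin n → Bool) → Prop)
    (hE : ∀ A, IsGraph A → |dbar (adjMat A) - dbar Q| ≤ 2 * dbar Q * x →
      (∀ T : Finset (Fin n), T.card = k → ∑ i ∈ T, rowSum (adjMat A) i ≤ k * M) → E A) :
    1 - (2 * Real.exp (-(n * dbar Q * x ^ 2 / 2)) +
      n.choose k * Real.exp (k * (4 * D) - k * M)) ≤ erProb Q E := by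
  have hn0 : (0 : ℝ) < n := by exact_mod_cast hn
  let sgn : Bool → ℝ := fun σ => if σ then x else -x
  have hsgn : ∀ σ, |sgn σ| ≤ 1 := fun σ => by
    cases σ <;> simpa [sgn, abs_of_pos hx0] using hx1
  have hsq : ∀ σ, sgn σ ^ 2 = x ^ 2 := fun σ => by cases σ <;> simp [sgn]
  have h := one_sub_le_erProb hQ
    ((Finset.univ : Finset Bool).disjSum (Finset.powersetCard k (Finset.univ : Finset (Fin n))))
    (Sum.elim (fun σ A => sgn σ * (n * dbar (adjMat A) - n * dbar Q) / 2 -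
      n * dbar Q * sgn σ ^ 2) (fun T A => ∑ i ∈ T, rowSum (adjMat A) i - k * M))
    (Sum.elim (fun _ => Real.exp (-(n * dbar Q * x ^ 2 / 2)))
      (fun _ => Real.exp (k * (4 * D) - k * M))) E ?_ ?_
  · simpa [Finset.sum_disjSum] using h
  · rintro (σ | T) hT
    · have := sum_erWeight_mul_exp_dbar_le hs hd hQ (hsgn σ)
      simpa only [Sum.elim_inl, hsq] using this
    · have hT' : T.card = k := by simpa using hT
      have := sum_erWeight_mul_exp_sum_rowSum_le hs hd hQ hD T (k * M)
      rw [hT'] at this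
      simpa only [Sum.elim_inr] using this
  · intro A hA hF
    refine hE A hA ?_ fun T hT => ?_
    · have h1 := hF (Sum.inl true) (by simp)
      have h2 := hF (Sum.inl false) (by simp)
      simp only [Sum.elim_inl, sgn, if_true, Bool.false_eq_true, if_false] at h1 h2
      have hnx : 0 < n * x := by positivity
      rw [abs_le]
      constructor <;> refine le_of_mul_le_mul_left ?_ hnx <;> nlinarith
    · have := hF (Sum.inr T) (by simpa using hT)
      simp only [Sum.elim_inr] at this
      linarith

lemma rowSum_le_of_forall_le_div {n : ℕ} {Q : Matrix (Fin n) (Fin n) ℝ} {D : ℝ}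
    (h : ∀ i j, Q i j ≤ D / n) (i : Fin n) : rowSum Q i ≤ D := by
  have hn : (n : ℝ) ≠ 0 := by
    have := i.pos
    positivity
  calc rowSum Q i ≤ ∑ _j : Fin n, D / n := Finset.sum_le_sum fun j _ => h i j
    _ = D := by simp [mul_div_cancel₀ _ hn]

lemma two_mul_exp_add_inv_le_rpow {n : ℕ} (hn : 9 ≤ n) :
    2 * Real.exp (-(25 / 2 * Real.log n)) + (n : ℝ)⁻¹ ≤ (n : ℝ) ^ (-(1 / 2) : ℝ) := by
  have hn9 : (9 : ℝ) ≤ n := by exact_mod_cast hn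
  have hn0 : (0 : ℝ) < n := by linarith
  have hlog : 0 ≤ Real.log n := Real.log_nonneg (by linarith)
  have h1 : Real.exp (-(25 / 2 * Real.log n)) ≤ (n : ℝ)⁻¹ := by
    rw [← Real.exp_log (inv_pos.2 hn0), Real.log_inv]
    exact Real.exp_le_exp.2 (by linarith)
  have h3 : 3 ≤ Real.sqrt n := Real.le_sqrt_of_sq_le (by linarith)
  rw [Real.rpow_neg hn0.le, ← Real.sqrt_eq_rpow]
  have h4 : 3 * (n : ℝ)⁻¹ ≤ (Real.sqrt n)⁻¹ := by
    rw [← div_eq_mul_inv, div_le_iff₀ hn0, inv_mul_eq_div, le_div_iff₀ (by linarith)]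
    nlinarith [Real.mul_self_sqrt hn0.le]
  linarith

lemma mul_log_le_self {n : ℕ} (hn : 10000 ≤ n) : 25 * Real.log n ≤ n := by
  have hn' : (10000 : ℝ) ≤ n := by exact_mod_cast hn
  have hn0 : (0 : ℝ) < n := by linarith
  have h1 := Real.log_le_sub_one_of_pos (Real.sqrt_pos.2 hn0)
  rw [Real.log_sqrt hn0.le] at h1
  have h2 : 100 ≤ Real.sqrt n := Real.le_sqrt_of_sq_le (by linarith)
  nlinarith [Real.mul_self_sqrt hn0.le]

/-- feasibility for fine estimation of inhomogeneous random
graphs. -/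
theorem fine_feasibility_inhomo :
    ∃ c > (0 : ℝ), ∃ c' > (0 : ℝ), ∃ N : ℕ, ∀ n ≥ N,
      ∀ (Q : Matrix (Fin n) (Fin n) ℝ) (R η : ℝ),
        (∀ i j, Q i j = Q j i) → (∀ i, Q i i = 0) →
        (∀ i j, 0 ≤ Q i j ∧ Q i j ≤ 1) →
        1 ≤ dbar Q → 1 ≤ R → (∀ i j, Q i j ≤ R * dbar Q / n) →
        5 ≤ R * dbar Q →
        0 < η → η < 1 / Real.exp 1 → η * Real.log (1 / η) * R ≤ c →
        1 - (n : ℝ) ^ (-c' : ℝ) ≤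
          erProb Q (fun A₀ =>
            ∀ A : Fin n → Fin n → Bool, IsGraph A →
              (nodeDist A A₀ : ℝ) ≤ η * n →
              ∀ dhat : ℝ, dbar Q / 2 ≤ dhat →
                ∃ (Astar : Fin n → Fin n → Bool) (zstar : Fin n → ℝ),
                  IsGraph Astar ∧
                  |dbar (adjMat Astar) - dbar Q| ≤
                    10 * Real.sqrt (dbar Q * Real.log n / n) +
                      2 * η * Real.log (1 / η) * R * dbar Q ∧
                  P1 (adjMat A) (2 * η) (adjMat Astar) zstar ∧
                  ∀ i, rowSum (adjMat Astar) i ≤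
                    10 * Real.log (1 / η) * R * dhat) := by
  refine ⟨Real.exp (-20), Real.exp_pos _, 1 / 2, by norm_num, 10000, ?_⟩
  intro n hnN Q R η hs hd hQ hd1 hR hQR hRd hη hηe hηc
  have hn0 : (0 : ℝ) < n := by
    have : 0 < n := by omega
    exact_mod_cast this
  have hd0 : 0 < dbar Q := by linarith
  have hℓ1 : 1 ≤ Real.log (1 / η) := by
    rw [Real.le_log_iff_exp_le (by positivity), le_div_iff₀ hη, mul_comm]
    exact ((lt_div_iff₀ (Real.exp_pos 1)).1 hηe).le
  have hℓ : 20 ≤ Real.log (1 / η) := by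
    have h1 : η ≤ Real.exp (-20) := by
      refine le_trans ?_ hηc
      rw [mul_assoc]
      exact le_mul_of_one_le_right hη.le (one_le_mul_of_one_le_of_one_le hℓ1 hR)
    rw [one_div, Real.log_inv]
    have := (Real.log_le_iff_le_exp hη).2 h1
    linarith
  have hη1 : η ≤ 1 := hηe.le.trans (by
    rw [div_le_one (Real.exp_pos 1)]
    linarith [Real.add_one_le_exp (1 : ℝ)])
  obtain ⟨k, hk1, hkn, hkη, hηk⟩ := exists_nat_of_mul_le (n := n) (by omega) hη.le hη1
  have hlog : 0 < Real.log n := Real.log_pos (by exact_mod_cast (by omega : 1 < n))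
  set q := Real.log n / (n * dbar Q) with hq
  have hq0 : 0 < q := by positivity
  have hsqrt : Real.sqrt (dbar Q * Real.log n / n) = dbar Q * Real.sqrt q := by
    have : dbar Q * Real.log n / n = dbar Q ^ 2 * q := by rw [hq]; field_simp
    rw [this, Real.sqrt_mul (by positivity), Real.sqrt_sq hd0.le]
  have hx1 : 5 * Real.sqrt q ≤ 1 := by
    have : Real.sqrt q ≤ 1 / 5 := by
      refine Real.sqrt_le_iff.2 ⟨by norm_num, ?_⟩
      rw [hq, div_le_iff₀ (by positivity)]
      nlinarith [mul_log_le_self (n := n) (by omega)]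
    linarith
  have htail : n * dbar Q * (5 * Real.sqrt q) ^ 2 / 2 = 25 / 2 * Real.log n := by
    rw [mul_pow, Real.sq_sqrt hq0.le, hq]
    field_simp
    norm_num
  have hfail := two_mul_exp_add_inv_le_rpow (n := n) (by omega)
  have hunion := choose_mul_exp_le_inv (n := n) (by omega) hη hℓ hRd hk1 hηk
  refine le_trans ?_ (one_sub_le_erProb_of_typical (k := k) (x := 5 * Real.sqrt q)
    (M := Real.log (1 / η) * (R * dbar Q)) hs hd hQ (rowSum_le_of_forall_le_div hQR)
    (by positivity) hx1 (by omega) _ ?_)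
  · rw [htail]
    linarith
  · intro A₀ hA₀ hdev hdeg A _ hdist dhat hdhat
    obtain ⟨Y, z, hY, hYd, hP, hrow⟩ := exists_feasible_of_sum_rowSum_le hA₀ hη.le
      (by positivity) hdist hk1 hkn hkη hdeg
    refine ⟨Y, z, hY, ?_, hP, fun i => (hrow i).trans ?_⟩
    · rw [hsqrt]
      have := abs_sub_le (dbar (adjMat Y)) (dbar (adjMat A₀)) (dbar Q)
      linarith
    · have : 0 ≤ Real.log (1 / η) * R := by positivity
      nlinarith

end EdgeDensity
end

section
/- Let n ∈ ℕ, let A ∈ ℝ^{n×n} be symmetric, let σ, δ, d̂ ≥ 0, and let γ, γ* ∈ [0,1] satisfy γ + γ* < 1. Suppose there exists a pair (A*, z*) satisfying the feasibility constraints P1(A, γ*) such that |(A*·𝟙)_i − d(A*)| ≤ σ·√d̂ for all i and ‖A* − (d(A*)/n)·𝟙𝟙ᵀ‖ ≤ δ·√d̂, where ‖·‖ denotes the spectral norm. Then every pair (Y, z) satisfying P1(A, γ) with |(Y·𝟙)_i − d(Y)| ≤ σ·√d̂ for all i and ‖Y − (d(Y)/n)·𝟙𝟙ᵀ‖ ≤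 δ·√d̂ obeys |d(Y) − d(A*)| ≤ ( 4·(γ+γ*)·σ·√d̂ + 2·(γ+γ*)·δ·√d̂ ) / (1 − γ − γ*)². -/
open scoped BigOperators Classical

namespace EdgeDensity

/-- A quadratic form is bounded by the spectral norm times the squared Euclidean norm. -/
lemma abs_quadForm_le_specNorm {n : ℕ} (M : Matrix (Fin n) (Fin n) ℝ) (u : Fin n → ℝ) :
    |∑ i, ∑ j, M i j * u i * u j| ≤ specNorm M * ∑ i, u i ^ 2 := by
  set v : EuclideanSpace ℝ (Fin n) := WithLp.toLp 2 u
  set L := LinearMap.toContinuousLinearMap (Matrix.toEuclideanLin M)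
  have hquad : ∑ i, ∑ j, M i j * u i * u j = inner ℝ v (L v) := by
    simp only [L, v, PiLp.inner_apply, LinearMap.coe_toContinuousLinearMap',
      Matrix.toLpLin_toLp, Matrix.toLin'_apply, Matrix.mulVec, dotProduct, RCLike.inner_apply,
      conj_trivial,
      Finset.sum_mul]
    exact Finset.sum_congr rfl fun i _ => Finset.sum_congr rfl fun j _ => by ring
  have hnorm : ∑ i, u i ^ 2 = ‖v‖ ^ 2 := by
    simp [EuclideanSpace.norm_sq_eq, v]
  have hL : ‖L v‖ ≤ specNorm M * ‖v‖ := L.le_opNorm v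
  rw [hquad, hnorm]
  calc |inner ℝ v (L v)| ≤ ‖v‖ * ‖L v‖ := abs_real_inner_le_norm _ _
    _ ≤ ‖v‖ * (specNorm M * ‖v‖) := by gcongr
    _ = specNorm M * ‖v‖ ^ 2 := by ring

/-- For a symmetric matrix with nearly constant row sums and small spectral deviation from
the constant matrix, the mass on a principal submatrix is close to that of the constant
matrix. -/
lemma abs_sum_submatrix_sub_le {n : ℕ} (hn : 0 < n) (M : Matrix (Fin n) (Fin n) ℝ)
    (hM : ∀ i j, M i j = M j i) {s t : ℝ}
    (hdeg : ∀ i, |rowSum M i - dbar M| ≤ s)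
    (hspec : specNorm (Matrix.of fun i j => M i j - dbar M / n) ≤ t)
    (w : Fin n → ℝ) (hw : ∀ i, w i = 0 ∨ w i = 1) :
    |∑ i, ∑ j, M i j * w i * w j - dbar M / n * (∑ i, w i) ^ 2| ≤
      (n - ∑ i, w i) * (2 * s + t) := by
  have hn' : (n : ℝ) ≠ 0 := by positivity
  set d := dbar M with hd
  set u : Fin n → ℝ := fun i => 1 - w i with hu
  have hu0 : ∀ i, 0 ≤ u i := fun i => by rcases hw i with h | h <;> simp [hu, h]
  have husq : ∑ i, u i ^ 2 = ∑ i, u i :=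
    Finset.sum_congr rfl fun i _ => by rcases hw i with h | h <;> simp [hu, h]
  have husum : ∑ i, u i = n - ∑ i, w i := by simp [hu, Finset.sum_sub_distrib]
  have hrow : ∀ i, ∑ j, (M i j - d / n) = rowSum M i - d := fun i => by
    simp only [Finset.sum_sub_distrib, rowSum, Finset.sum_const, Finset.card_univ,
      Fintype.card_fin, nsmul_eq_mul]
    field_simp
  have htot : ∑ i, ∑ j, (M i j - d / n) = 0 := by
    simp only [Finset.sum_sub_distrib, Finset.sum_const, Finset.card_univ,
      Fintype.card_fin, nsmul_eq_mul, hd, dbar]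
    field_simp
    ring
  have hcross : ∑ i, ∑ j, (M i j - d / n) * u i = ∑ i, u i * (rowSum M i - d) :=
    Finset.sum_congr rfl fun i _ => by rw [← Finset.sum_mul, hrow, mul_comm]
  have hcross' : ∑ i, ∑ j, (M i j - d / n) * u j = ∑ i, u i * (rowSum M i - d) := by
    rw [← hcross, Finset.sum_comm]
    exact Finset.sum_congr rfl fun i _ => Finset.sum_congr rfl fun j _ => by rw [hM]
  have hconst : d / n * (∑ i, w i) ^ 2 = ∑ i, ∑ j, d / n * w i * w j := by
    rw [sq, Finset.sum_mul_sum, Finset.mul_sum]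
    refine Finset.sum_congr rfl fun i _ => ?_
    rw [Finset.mul_sum]
    exact Finset.sum_congr rfl fun j _ => by ring
  have hexpand : ∑ i, ∑ j, M i j * w i * w j - d / n * (∑ i, w i) ^ 2 =
      ∑ i, ∑ j, (M i j - d / n) * u i * u j - 2 * ∑ i, u i * (rowSum M i - d) := by
    have h : ∑ i, ∑ j, M i j * w i * w j - d / n * (∑ i, w i) ^ 2 =
        ∑ i, ∑ j, (M i j - d / n) - ∑ i, ∑ j, (M i j - d / n) * u i
          - ∑ i, ∑ j, (M i j - d / n) * u j + ∑ i, ∑ j, (M i j - d / n) * u i * u j := by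
      rw [hconst]
      simp only [← Finset.sum_sub_distrib, ← Finset.sum_add_distrib]
      exact Finset.sum_congr rfl fun i _ => Finset.sum_congr rfl fun j _ => by
        simp only [hu]; ring
    rw [h, htot, hcross, hcross']
    ring
  have hlin : |∑ i, u i * (rowSum M i - d)| ≤ (∑ i, u i) * s := by
    rw [Finset.sum_mul]
    refine (Finset.abs_sum_le_sum_abs _ _).trans (Finset.sum_le_sum fun i _ => ?_)
    rw [abs_mul, abs_of_nonneg (hu0 i)]
    exact mul_le_mul_of_nonneg_left (hdeg i) (hu0 i)
  have hquad : |∑ i, ∑ j, (M i j - d / n) * u i * u j| ≤ (∑ i, u i) * t := by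
    refine (abs_quadForm_le_specNorm (Matrix.of fun i j => M i j - d / n) u).trans ?_
    rw [husq, mul_comm]
    exact mul_le_mul_of_nonneg_left hspec (Finset.sum_nonneg fun i _ => hu0 i)
  rw [hexpand, ← husum]
  rw [abs_le] at hlin hquad ⊢
  constructor <;> linarith [hlin.1, hlin.2, hquad.1, hquad.2]

/-- fine identifiability for Erdős–Rényi random graphs under
degree and spectral regularity constraints. -/
theorem fine_identifiability_er (n : ℕ) (A : Matrix (Fin n) (Fin n) ℝ)
    (hA : ∀ i j, A i j = A j i)
    (σ δ dhat γ γs : ℝ) (hσ : 0 ≤ σ) (hδ : 0 ≤ δ) (hdhat : 0 ≤ dhat)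
    (hγ0 : 0 ≤ γ) (hγ1 : γ ≤ 1) (hγs0 : 0 ≤ γs) (hγs1 : γs ≤ 1)
    (hsum : γ + γs < 1)
    (Astar : Matrix (Fin n) (Fin n) ℝ) (zstar : Fin n → ℝ)
    (hfeas : P1 A γs Astar zstar)
    (hdeg : ∀ i, |rowSum Astar i - dbar Astar| ≤ σ * Real.sqrt dhat)
    (hspec : specNorm (Matrix.of fun i j => Astar i j - dbar Astar / n) ≤
      δ * Real.sqrt dhat)
    (Y : Matrix (Fin n) (Fin n) ℝ) (z : Fin n → ℝ)
    (hY : P1 A γ Y z)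
    (hYdeg : ∀ i, |rowSum Y i - dbar Y| ≤ σ * Real.sqrt dhat)
    (hYspec : specNorm (Matrix.of fun i j => Y i j - dbar Y / n) ≤
      δ * Real.sqrt dhat) :
    |dbar Y - dbar Astar| ≤
      (4 * (γ + γs) * σ * Real.sqrt dhat + 2 * (γ + γs) * δ * Real.sqrt dhat) /
        (1 - γ - γs) ^ 2 := by
  rcases Nat.eq_zero_or_pos n with rfl | hn
  · simp only [dbar, Nat.cast_zero, div_zero, sub_zero, abs_zero]
    positivity
  obtain ⟨hzs, hzssum, hAsymm, -, hAs⟩ := hfeas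
  obtain ⟨hz, hzsum, hYsymm, -, hYA⟩ := hY
  set w : Fin n → ℝ := fun i => z i * zstar i with hwdef
  have hw : ∀ i, w i = 0 ∨ w i = 1 := fun i => by
    rcases hz i with h | h <;> rcases hzs i with h' | h' <;> simp [hwdef, h, h']
  have hwsum : (1 - γ - γs) * n ≤ ∑ i, w i := by
    have h : ∑ i, (z i + zstar i - 1) ≤ ∑ i, w i := Finset.sum_le_sum fun i _ => by
      rcases hz i with h | h <;> rcases hzs i with h' | h' <;> simp [hwdef, h, h']
    simp only [Finset.sum_sub_distrib, Finset.sum_add_distrib, Finset.sum_const,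
      Finset.card_univ, Fintype.card_fin, nsmul_eq_mul, mul_one] at h
    linarith
  have heq : ∑ i, ∑ j, Y i j * w i * w j = ∑ i, ∑ j, Astar i j * w i * w j :=
    Finset.sum_congr rfl fun i _ => Finset.sum_congr rfl fun j _ => by
      simp only [hwdef]
      linear_combination (zstar i * zstar j) * hYA i j - (z i * z j) * hAs i j
  have hYbound := abs_sum_submatrix_sub_le hn Y hYsymm hYdeg hYspec w hw
  have hAbound := abs_sum_submatrix_sub_le hn Astar hAsymm hdeg hspec w hw
  rw [heq] at hYbound
  set W := ∑ i, w i
  set r := Real.sqrt dhat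
  have hr : 0 ≤ r := Real.sqrt_nonneg _
  have hn0 : (0 : ℝ) < n := by exact_mod_cast hn
  have hg : 0 < 1 - γ - γs := by linarith
  have hK : 0 ≤ 2 * (2 * (σ * r) + δ * r) := by positivity
  have hdiff : |(dbar Y - dbar Astar) / n * W ^ 2| ≤
      (n - W) * (2 * (2 * (σ * r) + δ * r)) := by
    have h : (dbar Y - dbar Astar) / n * W ^ 2 =
        dbar Y / n * W ^ 2 - dbar Astar / n * W ^ 2 := by ring
    rw [h]
    rw [abs_le] at hYbound hAbound ⊢
    constructor <;> linarith [hYbound.1, hYbound.2, hAbound.1, hAbound.2]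
  rw [abs_mul, abs_div, abs_of_pos hn0, abs_of_nonneg (sq_nonneg W)] at hdiff
  have hmain : |dbar Y - dbar Astar| / n * ((1 - γ - γs) * n) ^ 2 ≤
      ((γ + γs) * n) * (2 * (2 * (σ * r) + δ * r)) :=
    calc |dbar Y - dbar Astar| / n * ((1 - γ - γs) * n) ^ 2
        ≤ |dbar Y - dbar Astar| / n * W ^ 2 := by gcongr
      _ ≤ (n - W) * (2 * (2 * (σ * r) + δ * r)) := hdiff
      _ ≤ ((γ + γs) * n) * (2 * (2 * (σ * r) + δ * r)) :=
        mul_le_mul_of_nonneg_right (by linarith) hK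
  rw [le_div_iff₀ (by positivity)]
  refine le_of_mul_le_mul_right ?_ hn0
  calc |dbar Y - dbar Astar| * (1 - γ - γs) ^ 2 * n
      = |dbar Y - dbar Astar| / n * ((1 - γ - γs) * n) ^ 2 := by field_simp
    _ ≤ _ := hmain
    _ = _ := by ring

end EdgeDensity
end
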